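/- arXiv:2503.10176 — 2 statements merged into one kernel-verified Lean document; each statement's English description precedes it below -/
import Mathlib

section
/- For all natural numbers m and n, the logic NpAmn enjoys the Craig interpolation property (CIP): whenever NpAmn ⊢ φ → ψ, there exists a modal formula χ such that V(χ) ⊆ V(φ) ∩ V(ψ), NpAmn ⊢ φ → χ, and NpAmn ⊢ χ → ψ. -/
/-- Propositional formulas. -/
inductive PropForm : Type
  | var : ℕ → PropForm
  | fls : PropForm
  | and : PropForm → PropForm → PropForm
  | or : PropForm → PropForm → PropForm
  | imp : PropForm → PropForm → PropForm
  deriving DecidableEq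

/-- Boolean evaluation of a propositional formula. -/
def PropForm.eval (v : ℕ → Bool) : PropForm → Bool
  | .var i => v i
  | .fls => false
  | .and φ ψ => φ.eval v && ψ.eval v
  | .or φ ψ => φ.eval v || ψ.eval v
  | .imp φ ψ => !φ.eval v || ψ.eval v

/-- Classical propositional tautology. -/
def PropForm.Taut (φ : PropForm) : Prop := ∀ v, φ.eval v = true

/-- Modal formulas. -/
inductive ModalForm : Type
  | var : ℕ → ModalForm
  | fls : ModalForm
  | and : ModalForm → ModalForm → ModalForm
  | or : ModalForm → ModalForm → ModalForm
  | imp : ModalForm → ModalForm → ModalForm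
  | box : ModalForm → ModalForm
  deriving DecidableEq

/-- Substitution of modal formulas for the variables of a propositional formula. -/
def PropForm.subst (σ : ℕ → ModalForm) : PropForm → ModalForm
  | .var i => σ i
  | .fls => .fls
  | .and φ ψ => .and (φ.subst σ) (ψ.subst σ)
  | .or φ ψ => .or (φ.subst σ) (ψ.subst σ)
  | .imp φ ψ => .imp (φ.subst σ) (ψ.subst σ)

/-- ¬φ abbreviates φ → ⊥. -/
def ModalForm.neg (φ : ModalForm) : ModalForm := .imp φ .fls

/-- □^k φ : k-fold application of □. -/
def ModalForm.boxIter : ℕ → ModalForm → ModalForm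
  | 0, φ => φ
  | k + 1, φ => .box (ModalForm.boxIter k φ)

/-- ¬^j φ : j-fold application of ¬. -/
def ModalForm.negIter : ℕ → ModalForm → ModalForm
  | 0, φ => φ
  | k + 1, φ => (ModalForm.negIter k φ).neg

/-- φ ↔ ψ abbreviates (φ → ψ) ∧ (ψ → φ). -/
def ModalForm.iff (φ ψ : ModalForm) : ModalForm := .and (.imp φ ψ) (.imp ψ φ)

/-- Signed variables: `Vsgn φ true` is V⁺(φ), `Vsgn φ false` is V⁻(φ). -/
def ModalForm.Vsgn : ModalForm → Bool → Finset ℕ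
  | .var i, true => {i}
  | .var _, false => ∅
  | .fls, _ => ∅
  | .and φ ψ, b => φ.Vsgn b ∪ ψ.Vsgn b
  | .or φ ψ, b => φ.Vsgn b ∪ ψ.Vsgn b
  | .imp φ ψ, b => φ.Vsgn (!b) ∪ ψ.Vsgn b
  | .box φ, b => φ.Vsgn b

/-- Positive variables V⁺(φ). -/
def ModalForm.Vpos (φ : ModalForm) : Finset ℕ := φ.Vsgn true

/-- Negative variables V⁻(φ). -/
def ModalForm.Vneg (φ : ModalForm) : Finset ℕ := φ.Vsgn false

/-- All variables V(φ). -/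
def ModalForm.V (φ : ModalForm) : Finset ℕ := φ.Vpos ∪ φ.Vneg

/-- The logic NpAmn = NAmn + (Ros□ : from ¬□φ infer ¬□□φ). -/
inductive NpA (m n : ℕ) : ModalForm → Prop
  | taut (p : PropForm) (σ : ℕ → ModalForm) : p.Taut → NpA m n (p.subst σ)
  | amn (φ : ModalForm) : NpA m n (.imp (ModalForm.boxIter n φ) (ModalForm.boxIter m φ))
  | mp (φ ψ : ModalForm) : NpA m n (.imp φ ψ) → NpA m n φ → NpA m n ψ
  | nec (φ : ModalForm) : NpA m n φ → NpA m n (.box φ)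
  | rosbox (φ : ModalForm) : NpA m n (ModalForm.neg (.box φ)) →
      NpA m n (ModalForm.neg (.box (.box φ)))

namespace ModalForm

@[simp] theorem V_fls : V fls = ∅ := rfl

@[simp] theorem V_and (φ ψ : ModalForm) : (and φ ψ).V = φ.V ∪ ψ.V := by
  ext x; simp [V, Vpos, Vneg, Vsgn]; tauto

@[simp] theorem V_or (φ ψ : ModalForm) : (or φ ψ).V = φ.V ∪ ψ.V := by
  ext x; simp [V, Vpos, Vneg, Vsgn]; tauto

@[simp] theorem V_imp (φ ψ : ModalForm) : (imp φ ψ).V = φ.V ∪ ψ.V := by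
  ext x; simp [V, Vpos, Vneg, Vsgn]; tauto

@[simp] theorem V_neg (φ : ModalForm) : φ.neg.V = φ.V := by
  simp [neg]

@[simp] theorem V_box (φ : ModalForm) : (box φ).V = φ.V := rfl

@[simp] theorem V_boxIter (k : ℕ) (φ : ModalForm) : (boxIter k φ).V = φ.V := by
  induction k with
  | zero => rfl
  | succ k ih => simpa [boxIter] using ih

end ModalForm

open ModalForm

/-- The substitution sending the first three variables to `a`, `b` and `c`. -/
def substThree (a b c : ModalForm) : ℕ → ModalForm
  | 0 => a
  | 1 => b
  | _ => c

namespace NpA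

variable {m n : ℕ}

theorem imp_self (a : ModalForm) : NpA m n (.imp a a) :=
  taut (.imp (.var 0) (.var 0)) (substThree a a a) (by intro v; simp [PropForm.eval])

theorem imp_imp_left (a b : ModalForm) : NpA m n (.imp a (.imp b a)) :=
  taut (.imp (.var 0) (.imp (.var 1) (.var 0))) (substThree a b a)
    (by intro v; simp only [PropForm.eval]; cases v 0 <;> cases v 1 <;> rfl)

theorem imp_distrib (a b c : ModalForm) :
    NpA m n (.imp (.imp a (.imp b c)) (.imp (.imp a b) (.imp a c))) :=
  taut (.imp (.imp (.var 0) (.imp (.var 1) (.var 2)))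
      (.imp (.imp (.var 0) (.var 1)) (.imp (.var 0) (.var 2)))) (substThree a b c)
    (by intro v; simp only [PropForm.eval]; cases v 0 <;> cases v 1 <;> cases v 2 <;> rfl)

theorem fls_imp (a : ModalForm) : NpA m n (.imp .fls a) :=
  taut (.imp .fls (.var 0)) (substThree a a a) (by intro v; simp [PropForm.eval])

theorem neg_neg_imp (a : ModalForm) : NpA m n (.imp a.neg.neg a) :=
  taut (.imp (.imp (.imp (.var 0) .fls) .fls) (.var 0)) (substThree a a a)
    (by intro v; simp [PropForm.eval])

theorem and_intro (a b : ModalForm) : NpA m n (.imp a (.imp b (.and a b))) :=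
  taut (.imp (.var 0) (.imp (.var 1) (.and (.var 0) (.var 1)))) (substThree a b a)
    (by intro v; simp only [PropForm.eval]; cases v 0 <;> cases v 1 <;> rfl)

theorem and_left (a b : ModalForm) : NpA m n (.imp (.and a b) a) :=
  taut (.imp (.and (.var 0) (.var 1)) (.var 0)) (substThree a b a)
    (by intro v; simp only [PropForm.eval]; cases v 0 <;> cases v 1 <;> rfl)

theorem and_right (a b : ModalForm) : NpA m n (.imp (.and a b) b) :=
  taut (.imp (.and (.var 0) (.var 1)) (.var 1)) (substThree a b a)
    (by intro v; simp only [PropForm.eval]; cases v 0 <;> cases v 1 <;> rfl)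

theorem or_inl (a b : ModalForm) : NpA m n (.imp a (.or a b)) :=
  taut (.imp (.var 0) (.or (.var 0) (.var 1))) (substThree a b a)
    (by intro v; simp only [PropForm.eval]; cases v 0 <;> cases v 1 <;> rfl)

theorem or_inr (a b : ModalForm) : NpA m n (.imp b (.or a b)) :=
  taut (.imp (.var 1) (.or (.var 0) (.var 1))) (substThree a b a)
    (by intro v; simp only [PropForm.eval]; cases v 0 <;> cases v 1 <;> rfl)

theorem or_elim (a b : ModalForm) :
    NpA m n (.imp (.or a b) (.imp a.neg (.imp b.neg .fls))) :=
  taut (.imp (.or (.var 0) (.var 1))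
      (.imp (.imp (.var 0) .fls) (.imp (.imp (.var 1) .fls) .fls))) (substThree a b a)
    (by intro v; simp only [PropForm.eval]; cases v 0 <;> cases v 1 <;> rfl)

theorem imp_trans {a b c : ModalForm} (h : NpA m n (.imp a b)) (h' : NpA m n (.imp b c)) :
    NpA m n (.imp a c) :=
  mp _ _ (mp _ _ (imp_distrib a b c) (mp _ _ (imp_imp_left _ a) h')) h

theorem imp_swap {a b c : ModalForm} (h : NpA m n (.imp a (.imp b c))) :
    NpA m n (.imp b (.imp a c)) :=
  imp_trans (imp_imp_left b a) (mp _ _ (imp_distrib a b c) h)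

theorem neg_box_boxIter {φ : ModalForm} (h : NpA m n (neg (.box φ))) (k : ℕ) :
    NpA m n (neg (.box (boxIter k φ))) := by
  induction k with
  | zero => exact h
  | succ k ih => exact rosbox _ ih

end NpA

/-- Derivability from a set of hypotheses, with modus ponens over the theorems of NpAmn. -/
inductive NpADer (m n : ℕ) (T : Set ModalForm) : ModalForm → Prop
  | thm (φ : ModalForm) : NpA m n φ → NpADer m n T φ
  | hyp (φ : ModalForm) : φ ∈ T → NpADer m n T φ
  | mp (φ ψ : ModalForm) : NpADer m n T (.imp φ ψ) → NpADer m n T φ → NpADer m n T ψ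

namespace NpADer

variable {m n : ℕ} {T : Set ModalForm}

theorem deduction {a b : ModalForm} (h : NpADer m n (insert a T) b) :
    NpADer m n T (.imp a b) := by
  induction h with
  | thm φ h => exact .thm _ (.mp _ _ (.imp_imp_left φ a) h)
  | hyp φ h =>
    rcases h with rfl | h
    · exact .thm _ (.imp_self _)
    · exact .mp _ _ (.thm _ (.imp_imp_left φ a)) (.hyp _ h)
  | mp φ ψ _ _ ih ih' => exact .mp _ _ (.mp _ _ (.thm _ (.imp_distrib a φ ψ)) ih) ih'

theorem exists_mem_of_sUnion {c : Set (Set ModalForm)} (hc : IsChain (· ⊆ ·) c)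
    (hne : c.Nonempty) {a : ModalForm} (h : NpADer m n (⋃₀ c) a) : ∃ t ∈ c, NpADer m n t a := by
  have mono : ∀ {s t : Set ModalForm}, s ⊆ t → ∀ {b}, NpADer m n s b → NpADer m n t b := by
    intro s t hst b hb
    induction hb with
    | thm φ h => exact .thm _ h
    | hyp φ h => exact .hyp _ (hst h)
    | mp φ ψ _ _ ih ih' => exact .mp _ _ ih ih'
  induction h with
  | thm φ h =>
    obtain ⟨t, ht⟩ := hne
    exact ⟨t, ht, .thm _ h⟩
  | hyp φ h =>
    obtain ⟨t, ht, h⟩ := h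
    exact ⟨t, ht, .hyp _ h⟩
  | mp φ ψ _ _ ih ih' =>
    obtain ⟨s, hs, hs'⟩ := ih
    obtain ⟨t, ht, ht'⟩ := ih'
    rcases hc.total hs ht with h | h
    · exact ⟨t, ht, .mp _ _ (mono h hs') ht'⟩
    · exact ⟨s, hs, .mp _ _ hs' (mono h ht')⟩

theorem exists_mem_imp (htop : ModalForm.neg .fls ∈ T)
    (hand : ∀ a ∈ T, ∀ b ∈ T, ModalForm.and a b ∈ T) {χ : ModalForm} (h : NpADer m n T χ) :
    ∃ θ ∈ T, NpA m n (.imp θ χ) := by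
  induction h with
  | thm φ h => exact ⟨_, htop, .mp _ _ (.imp_imp_left φ _) h⟩
  | hyp φ h => exact ⟨φ, h, .imp_self _⟩
  | mp φ ψ _ _ ih ih' =>
    obtain ⟨a, ha, ha'⟩ := ih
    obtain ⟨b, hb, hb'⟩ := ih'
    exact ⟨.and a b, hand a ha b hb, .mp _ _ (.mp _ _ (.imp_distrib _ φ ψ)
      (.imp_trans (.and_left a b) ha')) (.imp_trans (.and_right a b) hb')⟩

end NpADer

/-- A truth assignment to all modal formulas that respects the connectives. -/
structure IsBoolean (v : ModalForm → Prop) : Prop where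
  fls : ¬ v .fls
  and (a b : ModalForm) : v (.and a b) ↔ v a ∧ v b
  or (a b : ModalForm) : v (.or a b) ↔ v a ∨ v b
  imp (a b : ModalForm) : v (.imp a b) ↔ (v a → v b)

theorem IsBoolean.neg {v : ModalForm → Prop} (hv : IsBoolean v) (a : ModalForm) :
    v a.neg ↔ ¬ v a := by
  simp [ModalForm.neg, hv.imp, hv.fls]

open Classical in
theorem IsBoolean.subst_of_taut {v : ModalForm → Prop} (hv : IsBoolean v) {p : PropForm}
    (hp : p.Taut) (σ : ℕ → ModalForm) : v (p.subst σ) := by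
  have key : ∀ q : PropForm, v (q.subst σ) ↔ q.eval (fun i => decide (v (σ i))) = true := by
    intro q
    induction q with
    | var i => simp [PropForm.subst, PropForm.eval]
    | fls => simp [PropForm.subst, PropForm.eval, hv.fls]
    | and a b ha hb => simp [PropForm.subst, PropForm.eval, hv.and, ha, hb]
    | or a b ha hb => simp [PropForm.subst, PropForm.eval, hv.or, ha, hb]
    | imp a b ha hb =>
      simp only [PropForm.subst, PropForm.eval, hv.imp, ha, hb]
      cases a.eval _ <;> simp
  exact (key p).2 (hp _)

/-- A Boolean assignment satisfying every theorem of NpAmn. -/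
structure IsNpAWorld (m n : ℕ) (v : ModalForm → Prop) : Prop extends IsBoolean v where
  of_thm (a : ModalForm) : NpA m n a → v a

theorem exists_isNpAWorld {m n : ℕ} {T : Set ModalForm} (hT : ¬ NpADer m n T .fls) :
    ∃ v, IsNpAWorld m n v ∧ ∀ a ∈ T, v a := by
  obtain ⟨M, hTM, hM⟩ := zorn_subset_nonempty {S | ¬ NpADer m n S .fls}
    (fun c hc hchain hne => ⟨⋃₀ c, fun h => by
      obtain ⟨t, ht, h⟩ := NpADer.exists_mem_of_sUnion hchain hne h
      exact hc ht h, fun s hs => Set.subset_sUnion_of_mem hs⟩) T hT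
  have hcons : ¬ NpADer m n M .fls := hM.prop
  have neg_of : ∀ {a}, ¬ NpADer m n M a → NpADer m n M a.neg := by
    intro a ha
    by_contra hna
    have hmem : insert a M ∈ {S | ¬ NpADer m n S .fls} := fun h => hna h.deduction
    exact ha (.hyp _ (hM.le_of_ge hmem (Set.subset_insert a M) (Set.mem_insert a M)))
  have of_thm_mp : ∀ {a b}, NpA m n (.imp a b) → NpADer m n M a → NpADer m n M b :=
    fun h h' => .mp _ _ (.thm _ h) h'
  refine ⟨NpADer m n M, ⟨⟨hcons, fun a b => ⟨fun h => ⟨of_thm_mp (.and_left a b) h,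
    of_thm_mp (.and_right a b) h⟩, fun h => .mp _ _ (of_thm_mp (.and_intro a b) h.1) h.2⟩,
    fun a b => ⟨fun h => ?_, ?_⟩, fun a b => ⟨fun h h' => .mp _ _ h h', fun h => ?_⟩⟩,
    fun a h => .thm _ h⟩, fun a ha => .hyp _ (hTM ha)⟩
  · by_contra! hab
    exact hcons (.mp _ _ (.mp _ _ (of_thm_mp (.or_elim a b) h) (neg_of hab.1)) (neg_of hab.2))
  · rintro (h | h)
    exacts [of_thm_mp (.or_inl a b) h, of_thm_mp (.or_inr a b) h]
  · by_cases ha : NpADer m n M a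
    · exact of_thm_mp (.imp_imp_left b a) (h ha)
    · exact .mp _ _ (of_thm_mp (.imp_distrib a .fls b)
        (.thm _ (.mp _ _ (.imp_imp_left _ a) (.fls_imp b)))) (neg_of ha)

theorem exists_isNpAWorld_pair {m n : ℕ} {φ ψ : ModalForm} {C : Finset ℕ}
    (h : ¬ ∃ χ : ModalForm, χ.V ⊆ C ∧ NpA m n (.imp φ χ) ∧ NpA m n (.imp χ ψ)) :
    ∃ v w, IsNpAWorld m n v ∧ IsNpAWorld m n w ∧ v φ ∧ ¬ w ψ ∧
      ∀ a : ModalForm, a.V ⊆ C → (v a ↔ w a) := by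
  let T : Set ModalForm := {θ | θ.V ⊆ C ∧ NpA m n (.imp φ θ)}
  have hT : ¬ NpADer m n (insert ψ.neg T) .fls := fun hd => by
    obtain ⟨θ, ⟨hθ, hφ⟩, h'⟩ := hd.deduction.exists_mem_imp (T := T)
      ⟨by simp, .mp _ _ (.imp_imp_left _ _) (.imp_self _)⟩
      (fun a ha b hb => ⟨by simpa using Finset.union_subset ha.1 hb.1,
        .mp _ _ (.mp _ _ (.imp_distrib _ _ _) (.imp_trans ha.2 (.and_intro a b))) hb.2⟩)
    exact h ⟨θ, hθ, hφ, .imp_trans h' (.neg_neg_imp ψ)⟩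
  obtain ⟨w, hw, hwT⟩ := exists_isNpAWorld hT
  let S : Set ModalForm := {θ | θ.V ⊆ C ∧ w θ}
  have hS : ¬ NpADer m n (insert φ S) .fls := fun hd => by
    obtain ⟨θ, ⟨hθ, hwθ⟩, h'⟩ := hd.deduction.exists_mem_imp (T := S)
      ⟨by simp, hw.of_thm _ (.imp_self _)⟩
      (fun a ha b hb => ⟨by simpa using Finset.union_subset ha.1 hb.1,
        (hw.and a b).2 ⟨ha.2, hb.2⟩⟩)
    have hneg : θ.neg ∈ T := ⟨by simpa using hθ, .imp_swap h'⟩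
    exact (hw.neg θ).1 (hwT _ (Set.mem_insert_of_mem _ hneg)) hwθ
  obtain ⟨v, hv, hvS⟩ := exists_isNpAWorld hS
  refine ⟨v, w, hv, hw, hvS _ (Set.mem_insert _ _), (hw.neg ψ).1 (hwT _ (Set.mem_insert _ _)),
    fun a ha => ⟨fun hva => ?_, fun hwa => hvS _ (Set.mem_insert_of_mem _ ⟨ha, hwa⟩)⟩⟩
  by_contra hwa
  exact (hv.neg a).1
    (hvS _ (Set.mem_insert_of_mem _ ⟨by simpa using ha, (hw.neg a).2 hwa⟩)) hva

/-- The amalgam of two assignments: it follows `v` on variables and boxed formulas over `A`, and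
`w` on those over `B`; any other boxed formula is made as false as possible when `m = 0`, and as
true as possible otherwise. -/
def amalgam (m n : ℕ) (A B : Finset ℕ) (v w : ModalForm → Prop) : ModalForm → Prop
  | .var i => (i ∈ A ∧ v (.var i)) ∨ (i ∉ A ∧ w (.var i))
  | .fls => False
  | .and φ ψ => amalgam m n A B v w φ ∧ amalgam m n A B v w ψ
  | .or φ ψ => amalgam m n A B v w φ ∨ amalgam m n A B v w ψ
  | .imp φ ψ => amalgam m n A B v w φ → amalgam m n A B v w ψ
  | .box φ =>
    (φ.V ⊆ A ∧ v (.box φ)) ∨ (¬ φ.V ⊆ A ∧ φ.V ⊆ B ∧ w (.box φ)) ∨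
    (¬ φ.V ⊆ A ∧ ¬ φ.V ⊆ B ∧
      ((m = 0 ∧ amalgam m n A B v w φ ∧ NpA m n (.box φ)) ∨
       (m ≠ 0 ∧ (amalgam m n A B v w φ ∨ ¬ NpA m n (neg (.box φ))))))

section Amalgam

variable {m n : ℕ} {A B : Finset ℕ} {v w : ModalForm → Prop}

theorem isBoolean_amalgam : IsBoolean (amalgam m n A B v w) :=
  ⟨id, fun _ _ => Iff.rfl, fun _ _ => Iff.rfl, fun _ _ => Iff.rfl⟩

theorem amalgam_iff_left (hv : IsBoolean v) {a : ModalForm} (ha : a.V ⊆ A) :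
    amalgam m n A B v w a ↔ v a := by
  induction a with
  | var i =>
    have : i ∈ A := ha (by simp [V, Vpos, Vsgn])
    simp [amalgam, this]
  | fls => simp [amalgam, hv.fls]
  | and a b iha ihb =>
    rw [V_and, Finset.union_subset_iff] at ha
    simp [amalgam, hv.and, iha ha.1, ihb ha.2]
  | or a b iha ihb =>
    rw [V_or, Finset.union_subset_iff] at ha
    simp [amalgam, hv.or, iha ha.1, ihb ha.2]
  | imp a b iha ihb =>
    rw [V_imp, Finset.union_subset_iff] at ha
    simp [amalgam, hv.imp, iha ha.1, ihb ha.2]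
  | box a _ =>
    rw [V_box] at ha
    simp [amalgam, ha]

theorem amalgam_iff_right (hw : IsBoolean w)
    (hvw : ∀ a : ModalForm, a.V ⊆ A ∩ B → (v a ↔ w a)) {a : ModalForm} (ha : a.V ⊆ B) :
    amalgam m n A B v w a ↔ w a := by
  induction a with
  | var i =>
    by_cases hi : i ∈ A
    · have hB : i ∈ B := ha (by simp [V, Vpos, Vsgn])
      simp [amalgam, hi, hvw (.var i) (by simp [V, Vpos, Vneg, Vsgn, hi, hB])]
    · simp [amalgam, hi]
  | fls => simp [amalgam, hw.fls]
  | and a b iha ihb =>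
    rw [V_and, Finset.union_subset_iff] at ha
    simp [amalgam, hw.and, iha ha.1, ihb ha.2]
  | or a b iha ihb =>
    rw [V_or, Finset.union_subset_iff] at ha
    simp [amalgam, hw.or, iha ha.1, ihb ha.2]
  | imp a b iha ihb =>
    rw [V_imp, Finset.union_subset_iff] at ha
    simp [amalgam, hw.imp, iha ha.1, ihb ha.2]
  | box a _ =>
    rw [V_box] at ha
    by_cases hA : a.V ⊆ A
    · simp [amalgam, hA, hvw (.box a) (Finset.subset_inter hA ha)]
    · simp [amalgam, hA, ha]

theorem amalgam_box_of_eq_zero (hm : m = 0) {a : ModalForm} (hA : ¬ a.V ⊆ A) (hB : ¬ a.V ⊆ B) :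
    amalgam m n A B v w (.box a) ↔ amalgam m n A B v w a ∧ NpA m n (.box a) := by
  simp [amalgam, hA, hB, hm]

theorem amalgam_box_of_ne_zero (hm : m ≠ 0) {a : ModalForm} (hA : ¬ a.V ⊆ A)
    (hB : ¬ a.V ⊆ B) :
    amalgam m n A B v w (.box a) ↔ amalgam m n A B v w a ∨ ¬ NpA m n (neg (.box a)) := by
  simp [amalgam, hA, hB, hm]

theorem amalgam_of_boxIter (hm : m = 0) {a : ModalForm} (hA : ¬ a.V ⊆ A) (hB : ¬ a.V ⊆ B)
    (k : ℕ) (h : amalgam m n A B v w (boxIter k a)) : amalgam m n A B v w a := by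
  induction k with
  | zero => exact h
  | succ k ih =>
    exact ih ((amalgam_box_of_eq_zero hm (by simpa using hA) (by simpa using hB)).1 h).1

theorem amalgam_boxIter_succ (hm : m ≠ 0) {a : ModalForm} (hA : ¬ a.V ⊆ A) (hB : ¬ a.V ⊆ B)
    (k : ℕ) : amalgam m n A B v w (boxIter (k + 1) a) ↔
      amalgam m n A B v w a ∨ ¬ NpA m n (neg (.box a)) := by
  induction k with
  | zero => exact amalgam_box_of_ne_zero hm hA hB
  | succ k ih =>
    rw [boxIter, amalgam_box_of_ne_zero hm (by simpa using hA) (by simpa using hB), ih]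
    have : NpA m n (neg (.box a)) → NpA m n (neg (.box (boxIter (k + 1) a))) :=
      fun h => h.neg_box_boxIter _
    tauto

theorem isNpAWorld_amalgam (hv : IsNpAWorld m n v) (hw : IsNpAWorld m n w)
    (hvw : ∀ a : ModalForm, a.V ⊆ A ∩ B → (v a ↔ w a)) :
    IsNpAWorld m n (amalgam m n A B v w) := by
  refine ⟨isBoolean_amalgam, fun a ha => ?_⟩
  have of_subset : ∀ {a : ModalForm}, NpA m n a → a.V ⊆ A ∨ a.V ⊆ B →
      amalgam m n A B v w a := by
    rintro a h (hA | hB)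
    · exact (amalgam_iff_left hv.toIsBoolean hA).2 (hv.of_thm a h)
    · exact (amalgam_iff_right hw.toIsBoolean hvw hB).2 (hw.of_thm a h)
  have consistent : ∀ {a : ModalForm}, NpA m n a → ¬ NpA m n a.neg :=
    fun h h' => (hv.neg _).1 (hv.of_thm _ h') (hv.of_thm _ h)
  induction ha with
  | taut p σ hp => exact isBoolean_amalgam.subst_of_taut hp σ
  | amn φ =>
    by_cases h : φ.V ⊆ A ∨ φ.V ⊆ B
    · exact of_subset (.amn φ) (by simpa using h)
    obtain ⟨hA, hB⟩ := not_or.1 h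
    intro hn
    rcases Nat.eq_zero_or_pos m with hm | hm
    · have := amalgam_of_boxIter hm hA hB n hn
      rw [hm] at this ⊢
      exact this
    · obtain ⟨k, hk⟩ := Nat.exists_eq_succ_of_ne_zero hm.ne'
      have key : ∀ j, amalgam m n A B v w (boxIter j φ) →
          amalgam m n A B v w φ ∨ ¬ NpA m n (neg (.box φ)) := by
        rintro (_ | j) hj
        · exact .inl hj
        · exact (amalgam_boxIter_succ hm.ne' hA hB j).1 hj
      have := (amalgam_boxIter_succ hm.ne' hA hB k).2 (key n hn)
      rwa [← Nat.succ_eq_add_one, ← hk] at this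
  | mp φ ψ _ _ ih ih' => exact ih ih'
  | nec φ hφ ih =>
    by_cases h : φ.V ⊆ A ∨ φ.V ⊆ B
    · exact of_subset (.nec φ hφ) h
    obtain ⟨hA, hB⟩ := not_or.1 h
    rcases eq_or_ne m 0 with hm | hm
    · exact (amalgam_box_of_eq_zero hm hA hB).2 ⟨ih, .nec φ hφ⟩
    · exact (amalgam_box_of_ne_zero hm hA hB).2 (.inr (consistent (.nec φ hφ)))
  | rosbox φ hφ ih =>
    by_cases h : φ.V ⊆ A ∨ φ.V ⊆ B
    · exact of_subset (.rosbox φ hφ) (by simpa using h)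
    obtain ⟨hA, hB⟩ := not_or.1 h
    intro hbox
    rcases eq_or_ne m 0 with hm | hm
    · exact ih ((amalgam_box_of_eq_zero (a := .box φ) hm hA hB).1 hbox).1
    · rcases (amalgam_box_of_ne_zero (a := .box φ) hm hA hB).1 hbox with h' | h'
      · exact ih h'
      · exact h' (.rosbox φ hφ)

end Amalgam

/-- NpA enjoys the Craig interpolation property. -/
theorem NpA_CIP (m n : ℕ) (φ ψ : ModalForm) (h : NpA m n (.imp φ ψ)) :
    ∃ χ : ModalForm,
      χ.V ⊆ φ.V ∩ ψ.V ∧ NpA m n (.imp φ χ) ∧ NpA m n (.imp χ ψ) := by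
  by_contra hno
  obtain ⟨v, w, hv, hw, hφ, hψ, hvw⟩ := exists_isNpAWorld_pair hno
  have hu := isNpAWorld_amalgam hv hw hvw
  exact hψ ((amalgam_iff_right hw.toIsBoolean hvw subset_rfl).1
    ((hu.imp φ ψ).1 (hu.of_thm _ h) ((amalgam_iff_left hv.toIsBoolean subset_rfl).2 hφ)))
end

section
/- Let L be a set of modal formulas containing all substitution instances (by modal formulas) of classical propositional tautologies and closed under modus ponens, where L ⊢ φ means φ ∈ L. If L is locally tabular and enjoys the Lyndon interpolation property (LIP), then L enjoys the uniform Lyndon interpolation property (ULIP). -/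
/-- L enjoys the uniform Lyndon interpolation property. -/
def ULIP (L : ModalForm → Prop) : Prop :=
  ∀ (φ : ModalForm) (Pp Pm : Finset ℕ),
    ∃ χ : ModalForm,
      χ.Vpos ⊆ φ.Vpos \ Pp ∧ χ.Vneg ⊆ φ.Vneg \ Pm ∧
      L (.imp φ χ) ∧
      ∀ ψ : ModalForm, L (.imp φ ψ) →
        ψ.Vpos ∩ Pp = ∅ → ψ.Vneg ∩ Pm = ∅ → L (.imp χ ψ)

/-- L enjoys the uniform interpolation property. -/
def UIP (L : ModalForm → Prop) : Prop :=
  ∀ (φ : ModalForm) (P : Finset ℕ),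
    ∃ χ : ModalForm,
      χ.V ⊆ φ.V \ P ∧ L (.imp φ χ) ∧
      ∀ ψ : ModalForm, L (.imp φ ψ) → ψ.V ∩ P = ∅ → L (.imp χ ψ)

/-- L enjoys the Lyndon interpolation property. -/
def LIP (L : ModalForm → Prop) : Prop :=
  ∀ φ ψ : ModalForm, L (.imp φ ψ) →
    ∃ χ : ModalForm,
      χ.Vpos ⊆ φ.Vpos ∩ ψ.Vpos ∧ χ.Vneg ⊆ φ.Vneg ∩ ψ.Vneg ∧
      L (.imp φ χ) ∧ L (.imp χ ψ)

/-- L enjoys the Craig interpolation property. -/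
def CIP (L : ModalForm → Prop) : Prop :=
  ∀ φ ψ : ModalForm, L (.imp φ ψ) →
    ∃ χ : ModalForm, χ.V ⊆ φ.V ∩ ψ.V ∧ L (.imp φ χ) ∧ L (.imp χ ψ)

/-- L is locally tabular: for each finite set P of variables, there are only
finitely many equivalence classes (witnessed by a finite set of representatives)
of formulas over P modulo L-provable equivalence. -/
def LocallyTabular (L : ModalForm → Prop) : Prop :=
  ∀ P : Finset ℕ, ∃ S : Finset ModalForm,
    ∀ φ : ModalForm, φ.V ⊆ P → ∃ χ ∈ S, L (φ.iff χ)

section ClassicalReasoning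

variable {L : ModalForm → Prop}
  (htaut : ∀ (p : PropForm) (σ : ℕ → ModalForm), p.Taut → L (p.subst σ))
  (hmp : ∀ φ ψ : ModalForm, L (.imp φ ψ) → L φ → L ψ)
include htaut

theorem provable_imp_verum (φ : ModalForm) : L (.imp φ (.imp .fls .fls)) := by
  refine htaut (.imp (.var 0) (.imp .fls .fls)) (fun _ => φ) fun v => ?_
  simp [PropForm.eval]

theorem provable_and_imp_left (φ ψ : ModalForm) : L (.imp (.and φ ψ) φ) := by
  refine htaut (.imp (.and (.var 0) (.var 1)) (.var 0)) (fun | 0 => φ | _ => ψ) fun v => ?_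
  cases h : v 0 <;> simp [PropForm.eval, h]

theorem provable_and_imp_right (φ ψ : ModalForm) : L (.imp (.and φ ψ) ψ) := by
  refine htaut (.imp (.and (.var 0) (.var 1)) (.var 1)) (fun | 0 => φ | _ => ψ) fun v => ?_
  cases h : v 1 <;> simp [PropForm.eval, h]

include hmp

theorem provable_imp_trans {φ ψ χ : ModalForm} (h₁ : L (.imp φ ψ)) (h₂ : L (.imp ψ χ)) :
    L (.imp φ χ) := by
  refine hmp _ _ (hmp _ _ (htaut (.imp (.imp (.var 0) (.var 1))
    (.imp (.imp (.var 1) (.var 2)) (.imp (.var 0) (.var 2))))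
    (fun | 0 => φ | 1 => ψ | _ => χ) fun v => ?_) h₁) h₂
  cases h0 : v 0 <;> cases h1 : v 1 <;> cases h2 : v 2 <;> simp [PropForm.eval, h0, h1, h2]

theorem provable_imp_and {φ ψ χ : ModalForm} (h₁ : L (.imp φ ψ)) (h₂ : L (.imp φ χ)) :
    L (.imp φ (.and ψ χ)) := by
  refine hmp _ _ (hmp _ _ (htaut (.imp (.imp (.var 0) (.var 1))
    (.imp (.imp (.var 0) (.var 2)) (.imp (.var 0) (.and (.var 1) (.var 2)))))
    (fun | 0 => φ | 1 => ψ | _ => χ) fun v => ?_) h₁) h₂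
  cases h0 : v 0 <;> cases h1 : v 1 <;> cases h2 : v 2 <;> simp [PropForm.eval, h0, h1, h2]

/-- Among the consequences of `φ` with prescribed signed variables there is one that implies every
such consequence equivalent to a member of the finite set `S`. -/
theorem exists_consequence_imp_of_mem (φ : ModalForm) (A B : Finset ℕ) (S : Finset ModalForm) :
    ∃ χ : ModalForm, χ.Vpos ⊆ A ∧ χ.Vneg ⊆ B ∧ L (.imp φ χ) ∧
      ∀ θ : ModalForm, θ.Vpos ⊆ A → θ.Vneg ⊆ B → L (.imp φ θ) →
        ∀ s ∈ S, L (θ.iff s) → L (.imp χ s) := by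
  induction S using Finset.induction_on with
  | empty =>
    exact ⟨.imp .fls .fls, by simp [ModalForm.Vpos, ModalForm.Vsgn],
      by simp [ModalForm.Vneg, ModalForm.Vsgn], provable_imp_verum htaut φ, by simp⟩
  | insert a S _ ih =>
    obtain ⟨χ, hp, hn, hφ, hχ⟩ := ih
    by_cases h : ∃ θ : ModalForm, θ.Vpos ⊆ A ∧ θ.Vneg ⊆ B ∧ L (.imp φ θ) ∧ L (θ.iff a)
    · obtain ⟨θ, tp, tn, tφ, ta⟩ := h
      refine ⟨.and θ χ, Finset.union_subset tp hp, Finset.union_subset tn hn,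
        provable_imp_and htaut hmp tφ hφ, fun η ep en eφ s hs e => ?_⟩
      rcases Finset.mem_insert.1 hs with rfl | hs
      · exact provable_imp_trans htaut hmp (provable_and_imp_left htaut θ χ)
          (hmp _ _ (provable_and_imp_left htaut _ _) ta)
      · exact provable_imp_trans htaut hmp (provable_and_imp_right htaut θ χ)
          (hχ η ep en eφ s hs e)
    · refine ⟨χ, hp, hn, hφ, fun η ep en eφ s hs e => ?_⟩
      rcases Finset.mem_insert.1 hs with rfl | hs
      · exact absurd ⟨η, ep, en, eφ, e⟩ h
      · exact hχ η ep en eφ s hs e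

end ClassicalReasoning


/-- For a locally tabular logic containing all substitution instances of classical
tautologies and closed under modus ponens, LIP implies ULIP. -/
theorem locally_tabular_lip_implies_ulip (L : ModalForm → Prop)
    (htaut : ∀ (p : PropForm) (σ : ℕ → ModalForm), p.Taut → L (p.subst σ))
    (hmp : ∀ φ ψ : ModalForm, L (.imp φ ψ) → L φ → L ψ)
    (hlt : LocallyTabular L) (hlip : LIP L) : ULIP L := by
  intro φ Pp Pm
  obtain ⟨S, hS⟩ := hlt φ.V
  obtain ⟨χ, hp, hn, hφ, hχ⟩ :=
    exists_consequence_imp_of_mem htaut hmp φ (φ.Vpos \ Pp) (φ.Vneg \ Pm) S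
  refine ⟨χ, hp, hn, hφ, fun ψ hψ dp dn => ?_⟩
  obtain ⟨θ, tp, tn, tφ, tψ⟩ := hlip φ ψ hψ
  obtain ⟨tp₁, tp₂⟩ := Finset.subset_inter_iff.1 tp
  obtain ⟨tn₁, tn₂⟩ := Finset.subset_inter_iff.1 tn
  obtain ⟨s, hs, e⟩ := hS θ (Finset.union_subset_union tp₁ tn₁)
  have hχs := hχ θ
    (Finset.subset_sdiff.2 ⟨tp₁, (Finset.disjoint_iff_inter_eq_empty.2 dp).mono_left tp₂⟩)
    (Finset.subset_sdiff.2 ⟨tn₁, (Finset.disjoint_iff_inter_eq_empty.2 dn).mono_left tn₂⟩)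
    tφ s hs e
  exact provable_imp_trans htaut hmp hχs
    (provable_imp_trans htaut hmp (hmp _ _ (provable_and_imp_right htaut _ _) e) tψ)
end
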